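/- For n ≥ 3 an odd natural number, the rank of the ℤ-module V(ℤ/nℤ) equals (n−1)/2 + Σ_{d|n, d≠1} (φ(d)/(2|U_d|) − 1), where φ is Euler's totient function. Moreover, V(ℤ/1ℤ) has rank 0. -/

import Mathlib

open scoped BigOperators

/-- The minimal `k ≥ 1` such that `2^k ≡ ±1 (mod d)`. -/
noncomputable def Upow (d : ℕ) : ℕ :=
  sInf {k : ℕ | 1 ≤ k ∧ ((2 : ZMod d) ^ k = 1 ∨ (2 : ZMod d) ^ k = -1)}

/-- The set `U_d = {1, 2, 4, …, 2^{k-1}} ⊆ ℤ/dℤ`. -/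
noncomputable def Uset (d : ℕ) : Finset (ZMod d) :=
  (Finset.range (Upow d)).image (fun i => (2 : ZMod d) ^ i)

/-- `V(ℤ/nℤ)` as a ℤ-submodule of `ZMod n → ℤ`. -/
noncomputable def VM (n : ℕ) [NeZero n] : Submodule ℤ (ZMod n → ℤ) where
  carrier := {μ | (∀ g : ZMod n, μ g + μ (-g) = μ (2 * g) + μ (-(2 * g))) ∧
    ∀ H : AddSubgroup (ZMod n), ∑ᶠ g ∈ (H : Set (ZMod n)), μ g = 0}
  add_mem' := by
    rintro a b ⟨ha1, ha2⟩ ⟨hb1, hb2⟩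
    refine ⟨fun g => ?_, fun H => ?_⟩
    · have h1 := ha1 g
      have h2 := hb1 g
      simp only [Pi.add_apply]
      omega
    · have : ∑ᶠ g ∈ (H : Set (ZMod n)), (a + b) g
          = ∑ᶠ g ∈ (H : Set (ZMod n)), (a g + b g) := rfl
      rw [this, finsum_mem_add_distrib (Set.toFinite _), ha2 H, hb2 H, add_zero]
  zero_mem' := ⟨fun g => by simp, fun H => by simp⟩
  smul_mem' := by
    rintro c a ⟨ha1, ha2⟩
    refine ⟨fun g => ?_, fun H => ?_⟩
    · have h1 := ha1 g
      simp only [Pi.smul_apply, smul_eq_mul, ← mul_add, h1]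
    · have key : ∑ᶠ g ∈ (H : Set (ZMod n)), (c • a) g
          = ∑ g ∈ (Set.toFinite (H : Set (ZMod n))).toFinset, c * a g :=
        finsum_mem_eq_finite_toFinset_sum _ _
      have h2 := ha2 H
      rw [finsum_mem_eq_finite_toFinset_sum _ (Set.toFinite (H : Set (ZMod n)))] at h2
      rw [key, ← Finset.mul_sum, h2, mul_zero]

/-- `2` has a positive period modulo an odd number. -/
lemma exists_two_pow_eq_one {n : ℕ} (hodd : Odd n) : ∃ N : ℕ, 1 ≤ N ∧ (2 : ZMod n) ^ N = 1 := by
  have h2 : Nat.Coprime 2 n := Nat.coprime_two_left.2 hodd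
  refine ⟨n.totient, Nat.totient_pos.2 hodd.pos, ?_⟩
  have h := (ZMod.natCast_eq_natCast_iff _ _ _).2 (Nat.ModEq.pow_totient h2)
  simpa using h

lemma isUnit_two {n : ℕ} (hodd : Odd n) : IsUnit (2 : ZMod n) := by
  obtain ⟨N, hN, h⟩ := exists_two_pow_eq_one hodd
  exact IsUnit.of_pow_eq_one h (by omega)

section Upow

variable {d : ℕ}

lemma Upow_spec (hodd : Odd d) :
    1 ≤ Upow d ∧ ((2 : ZMod d) ^ Upow d = 1 ∨ (2 : ZMod d) ^ Upow d = -1) := by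
  obtain ⟨N, hN, h⟩ := exists_two_pow_eq_one hodd
  exact Nat.sInf_mem (s := {k : ℕ | 1 ≤ k ∧ ((2 : ZMod d) ^ k = 1 ∨ (2 : ZMod d) ^ k = -1)})
    ⟨N, hN, Or.inl h⟩

lemma Upow_le {k : ℕ} (hk : 1 ≤ k) (h : (2 : ZMod d) ^ k = 1 ∨ (2 : ZMod d) ^ k = -1) :
    Upow d ≤ k :=
  Nat.sInf_le (s := {k : ℕ | 1 ≤ k ∧ ((2 : ZMod d) ^ k = 1 ∨ (2 : ZMod d) ^ k = -1)}) ⟨hk, h⟩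

lemma two_pow_eq_or_neg_imp_le (hodd : Odd d) {i j : ℕ} (hj : j < Upow d)
    (h : (2 : ZMod d) ^ i = 2 ^ j ∨ (2 : ZMod d) ^ i = -2 ^ j) : j ≤ i := by
  by_contra! hij
  have hu : IsUnit ((2 : ZMod d) ^ i) := (isUnit_two hodd).pow i
  have hs : (2 : ZMod d) ^ j = 2 ^ i * 2 ^ (j - i) := by
    rw [← pow_add]; congr 1; omega
  have : Upow d ≤ j - i := by
    refine Upow_le (by omega) ?_
    rcases h with h | h
    · left
      apply hu.mul_left_cancel
      rw [← hs, h, mul_one]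
    · right
      apply hu.mul_left_cancel
      rw [← hs, h]
      ring
  omega

lemma two_pow_eq_or_neg_imp_eq (hodd : Odd d) {i j : ℕ} (hi : i < Upow d) (hj : j < Upow d)
    (h : (2 : ZMod d) ^ i = 2 ^ j ∨ (2 : ZMod d) ^ i = -2 ^ j) : i = j := by
  refine le_antisymm (two_pow_eq_or_neg_imp_le hodd hi ?_) (two_pow_eq_or_neg_imp_le hodd hj h)
  rcases h with h | h
  · exact Or.inl h.symm
  · right; rw [h, neg_neg]

lemma two_pow_ne_neg_self (hodd : Odd d) (h1 : d ≠ 1) (i : ℕ) :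
    (2 : ZMod d) ^ i ≠ -2 ^ i := by
  intro h
  have : Nontrivial (ZMod d) := ZMod.nontrivial_iff.2 h1
  have h0 : (2 : ZMod d) ^ (i + 1) = 0 := by
    rw [pow_succ, mul_two]
    nth_rewrite 1 [h]
    exact neg_add_cancel _
  exact ((isUnit_two hodd).pow (i + 1)).ne_zero h0

lemma card_Uset (hodd : Odd d) : (Uset d).card = Upow d := by
  unfold Uset
  rw [Finset.card_image_of_injOn, Finset.card_range]
  intro i hi j hj h
  exact two_pow_eq_or_neg_imp_eq hodd (by simpa using hi) (by simpa using hj) (Or.inl h)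

/-- The elements `±2^i` with `i < Upow d`, which are all the elements `±2^i` of `ℤ/dℤ`. -/
noncomputable def signedPowers (d : ℕ) : Finset (ZMod d) :=
  Uset d ∪ (Uset d).image (fun x => -x)

lemma mem_signedPowers (hodd : Odd d) (x : ZMod d) :
    x ∈ signedPowers d ↔ ∃ i : ℕ, x = 2 ^ i ∨ x = -2 ^ i := by
  unfold signedPowers Uset
  simp only [Finset.mem_union, Finset.mem_image, Finset.mem_range]
  constructor
  · rintro (⟨i, -, rfl⟩ | ⟨_, ⟨i, -, rfl⟩, rfl⟩)
    · exact ⟨i, Or.inl rfl⟩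
    · exact ⟨i, Or.inr rfl⟩
  · obtain ⟨hk, hk'⟩ := Upow_spec hodd
    rintro ⟨i, hi⟩
    have hlt : i % Upow d < Upow d := Nat.mod_lt _ hk
    have hpow : (2 : ZMod d) ^ i = 2 ^ (i % Upow d) ∨ (2 : ZMod d) ^ i = -2 ^ (i % Upow d) := by
      have hs : (2 : ZMod d) ^ i = (2 ^ Upow d) ^ (i / Upow d) * 2 ^ (i % Upow d) := by
        rw [← pow_mul, ← pow_add, Nat.div_add_mod]
      rcases hk' with h | h
      · left; rw [hs, h, one_pow, one_mul]
      · rw [hs, h]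
        rcases neg_one_pow_eq_or (ZMod d) (i / Upow d) with h' | h' <;> simp [h']
    rcases hi with rfl | rfl <;> rcases hpow with h | h
    · exact Or.inl ⟨_, hlt, h.symm⟩
    · exact Or.inr ⟨_, ⟨_, hlt, rfl⟩, h.symm⟩
    · exact Or.inr ⟨_, ⟨_, hlt, rfl⟩, by rw [h]⟩
    · exact Or.inl ⟨_, hlt, by rw [h, neg_neg]⟩

lemma card_signedPowers (hodd : Odd d) (h1 : d ≠ 1) :
    (signedPowers d).card = 2 * (Uset d).card := by
  unfold signedPowers
  rw [Finset.card_union_of_disjoint, Finset.card_image_of_injective _ neg_injective, two_mul]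
  rw [Finset.disjoint_left]
  intro x hx hx'
  simp only [Uset, Finset.mem_image, Finset.mem_range] at hx hx'
  obtain ⟨i, hi, rfl⟩ := hx
  obtain ⟨_, ⟨j, hj, rfl⟩, h⟩ := hx'
  obtain rfl := two_pow_eq_or_neg_imp_eq hodd hi hj (Or.inr h.symm)
  exact two_pow_ne_neg_self hodd h1 i h.symm

end Upow

/-- The orbit relation on `ℤ/nℤ` of multiplication by `2` and `-1`. -/
def doublingSetoid (n : ℕ) (hodd : Odd n) : Setoid (ZMod n) where
  r g h := ∃ i : ℕ, h = 2 ^ i * g ∨ h = -(2 ^ i * g)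
  iseqv := by
    refine ⟨fun g => ⟨0, by simp⟩, ?_, ?_⟩
    · rintro g h ⟨i, hi⟩
      obtain ⟨N, hN, hN'⟩ := exists_two_pow_eq_one hodd
      refine ⟨i * (N - 1), ?_⟩
      have key : (2 : ZMod n) ^ (i * (N - 1)) * 2 ^ i = 1 := by
        rw [← pow_add, ← Nat.mul_succ, Nat.succ_eq_add_one, Nat.sub_add_cancel hN, mul_comm,
          pow_mul, hN', one_pow]
      rcases hi with rfl | rfl
      · left; rw [← mul_assoc, key, one_mul]
      · right; rw [mul_neg, ← mul_assoc, key, one_mul, neg_neg]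
    · rintro g _ _ ⟨i, rfl | rfl⟩ ⟨j, rfl | rfl⟩ <;> refine ⟨j + i, ?_⟩
      · left; ring
      · right; ring
      · right; ring
      · left; ring

section Orbits

variable {n : ℕ} {hodd : Odd n}

lemma doublingSetoid_iff {g h : ZMod n} :
    (doublingSetoid n hodd) g h ↔ ∃ i : ℕ, h = 2 ^ i * g ∨ h = -(2 ^ i * g) := Iff.rfl

lemma addOrderOf_dvd_of_rel {g h : ZMod n} (hr : doublingSetoid n hodd g h) :
    addOrderOf h ∣ addOrderOf g := by
  obtain ⟨i, hi⟩ := hr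
  rw [addOrderOf_dvd_iff_nsmul_eq_zero]
  have h0 : addOrderOf g • (2 ^ i * g) = 0 := by
    rw [← mul_smul_comm, addOrderOf_nsmul_eq_zero, mul_zero]
  rcases hi with rfl | rfl
  · exact h0
  · rw [smul_neg, h0, neg_zero]

/-- The common additive order of the elements of an orbit. -/
noncomputable def orbitOrder (n : ℕ) (hodd : Odd n) : Quotient (doublingSetoid n hodd) → ℕ :=
  Quotient.lift (fun g : ZMod n => addOrderOf g) fun _ _ h =>
    Nat.dvd_antisymm (addOrderOf_dvd_of_rel ((doublingSetoid n hodd).symm h))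
      (addOrderOf_dvd_of_rel h)

variable [NeZero n]

open Classical in
lemma card_orbit (g : ZMod n) (hd : Odd (addOrderOf g)) (h1 : addOrderOf g ≠ 1) :
    (Finset.univ.filter fun h => doublingSetoid n hodd g h).card
      = 2 * (Uset (addOrderOf g)).card := by
  set d := addOrderOf g with hdef
  let f : {f : ℤ →+ ZMod n // f d = 0} :=
    ⟨zmultiplesHom _ g, by
      rw [zmultiplesHom_apply, natCast_zsmul, hdef, addOrderOf_nsmul_eq_zero]⟩
  let ψ := ZMod.lift d f
  have hψ : ∀ m : ℤ, ψ (m : ZMod d) = m * g := fun m => by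
    simp [ψ, f]
  have hinj : Function.Injective ψ := by
    rw [ZMod.lift_injective]
    intro m hm
    rw [ZMod.intCast_zmod_eq_zero_iff_dvd, hdef, addOrderOf_dvd_iff_zsmul_eq_zero]
    simpa [f] using hm
  rw [← card_signedPowers hd h1, ← Finset.card_image_of_injective _ hinj]
  congr 1
  ext h
  have e1 : ∀ i : ℕ, ψ (2 ^ i) = 2 ^ i * g := fun i => by
    simpa using hψ (2 ^ i)
  simp only [Finset.mem_filter, Finset.mem_univ, true_and, Finset.mem_image,
    mem_signedPowers hd, doublingSetoid_iff]
  constructor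
  · rintro ⟨i, rfl | rfl⟩
    · exact ⟨2 ^ i, ⟨i, Or.inl rfl⟩, e1 i⟩
    · exact ⟨-2 ^ i, ⟨i, Or.inr rfl⟩, by rw [map_neg, e1]⟩
  · rintro ⟨_, ⟨i, rfl | rfl⟩, rfl⟩
    · exact ⟨i, Or.inl (e1 i)⟩
    · exact ⟨i, Or.inr (by rw [map_neg, e1])⟩

noncomputable instance : Fintype (Quotient (doublingSetoid n hodd)) := Fintype.ofFinite _

lemma card_filter_addOrderOf {d : ℕ} (hd : d ∣ n) :
    (Finset.univ.filter fun g : ZMod n => addOrderOf g = d).card = d.totient :=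
  IsAddCyclic.card_addOrderOf_eq_totient (by rwa [ZMod.card])

open Classical in
lemma card_orbits_mul {d : ℕ} (hd : d ∣ n) (h1 : d ≠ 1) :
    (Finset.univ.filter fun q => orbitOrder n hodd q = d).card * (2 * (Uset d).card)
      = d.totient := by
  have hdo : Odd d := hodd.of_dvd_nat hd
  rw [← card_filter_addOrderOf hd, Finset.card_eq_sum_card_fiberwise
    (f := fun g => (Quotient.mk (doublingSetoid n hodd) g))
    (t := Finset.univ.filter fun q => orbitOrder n hodd q = d)]
  · rw [Finset.sum_congr rfl (g := fun _ => 2 * (Uset d).card), Finset.sum_const, smul_eq_mul]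
    intro q hq
    induction q using Quotient.inductionOn with
    | h g =>
      have hg : addOrderOf g = d := (Finset.mem_filter.1 hq).2
      subst hg
      rw [← card_orbit (hodd := hodd) g hdo h1]
      congr 1
      ext h
      simp only [Finset.mem_filter, Finset.mem_univ, true_and]
      constructor
      · rintro ⟨-, h⟩
        exact (doublingSetoid n hodd).symm (Quotient.exact h)
      · intro h
        have he : Quotient.mk (doublingSetoid n hodd) g = Quotient.mk _ _ := Quotient.sound h
        exact ⟨(congrArg (orbitOrder n hodd) he).symm, he.symm⟩
  · intro g hg
    have hg' : addOrderOf g = d := by simpa using hg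
    exact Finset.mem_coe.2 (Finset.mem_filter.2 ⟨Finset.mem_univ _, hg'⟩)

lemma orbitOrder_mem_divisors (q : Quotient (doublingSetoid n hodd)) :
    orbitOrder n hodd q ∈ n.divisors := by
  induction q using Quotient.inductionOn with
  | h g =>
    refine Nat.mem_divisors.2 ⟨?_, NeZero.ne n⟩
    change addOrderOf g ∣ n
    rw [addOrderOf_dvd_iff_nsmul_eq_zero]
    simp

open Classical in
lemma card_orbits_one :
    (Finset.univ.filter fun q => orbitOrder n hodd q = 1).card = 1 := by
  rw [Finset.card_eq_one]
  refine ⟨Quotient.mk _ 0, ?_⟩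
  ext q
  induction q using Quotient.inductionOn with
  | h g =>
    simp only [Finset.mem_filter, Finset.mem_univ, true_and, Finset.mem_singleton]
    constructor
    · intro h
      rw [AddMonoid.addOrderOf_eq_one_iff.1 h]
    · intro h
      rw [h]
      exact addOrderOf_zero

lemma card_orbits :
    Fintype.card (Quotient (doublingSetoid n hodd)) =
      ∑ d ∈ n.divisors.filter (fun d => d ≠ 1), (d.totient / (2 * (Uset d).card) - 1)
        + n.divisors.card := by
  classical
  rw [← Finset.card_univ, Finset.card_eq_sum_card_fiberwise (f := orbitOrder n hodd)
    (t := n.divisors) fun q _ => orbitOrder_mem_divisors q]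
  have h1 : 1 ∈ n.divisors := Nat.one_mem_divisors.2 (NeZero.ne n)
  have hf : n.divisors.filter (fun d => d ≠ 1) = n.divisors.erase 1 := by
    ext; simp [and_comm]
  rw [hf, ← Finset.add_sum_erase _ _ h1, card_orbits_one, ← Finset.card_erase_add_one h1,
    Finset.card_eq_sum_ones (n.divisors.erase 1), ← add_assoc, ← Finset.sum_add_distrib, add_comm]
  congr 1
  refine Finset.sum_congr rfl fun d hd => ?_
  obtain ⟨hd1, hd⟩ := Finset.mem_erase.1 hd
  have hdn := (Nat.mem_divisors.1 hd).1
  have hm := card_orbits_mul (hodd := hodd) hdn hd1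
  have hpos : 0 < d.totient := Nat.totient_pos.2 (Nat.pos_of_mem_divisors hd)
  have hu : 0 < 2 * (Uset d).card := by
    rw [card_Uset (hodd.of_dvd_nat hdn)]
    have := (Upow_spec (hodd.of_dvd_nat hdn)).1
    omega
  rw [← hm, Nat.mul_div_cancel _ hu]
  have : 0 < (Finset.univ.filter fun q => orbitOrder n hodd q = d).card := by
    rw [← hm] at hpos
    exact Nat.pos_of_mul_pos_right hpos
  omega

end Orbits

section Sums

variable {n : ℕ} [NeZero n]

/-- A subgroup `H` of `ℤ/nℤ` is the `|H|`-torsion subgroup. -/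
lemma mem_iff_card_nsmul_eq_zero (H : AddSubgroup (ZMod n)) (g : ZMod n) :
    g ∈ H ↔ Nat.card H • g = 0 := by
  classical
  have hsub : (H : Set (ZMod n)).toFinset ⊆ Finset.univ.filter fun g => Nat.card H • g = 0 := by
    intro g hg
    simp only [Finset.mem_filter, Finset.mem_univ, true_and]
    have hg' : g ∈ H := by simpa using hg
    exact congrArg Subtype.val (card_nsmul_eq_zero' (x := (⟨g, hg'⟩ : H)))
  have heq := Finset.eq_of_subset_of_card_le hsub (by
    refine (IsAddCyclic.card_nsmul_eq_zero_le Nat.card_pos).trans ?_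
    rw [Set.toFinset_card, Nat.card_eq_fintype_card]
    rfl)
  have := Finset.ext_iff.1 heq g
  simpa using this

lemma forall_addSubgroup_sum_iff (μ : ZMod n → ℤ) :
    (∀ H : AddSubgroup (ZMod n), ∑ᶠ g ∈ (H : Set (ZMod n)), μ g = 0) ↔
      ∀ d ∈ n.divisors, ∑ g ∈ Finset.univ.filter (fun g : ZMod n => d • g = 0), μ g = 0 := by
  constructor
  · intro h d _
    have := h (nsmulAddMonoidHom d : ZMod n →+ ZMod n).ker
    rw [← this, ← finsum_mem_coe_finset]
    have hs : ((Finset.univ.filter fun g : ZMod n => d • g = 0 : Finset (ZMod n)) : Set (ZMod n)) =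
        ((nsmulAddMonoidHom d : ZMod n →+ ZMod n).ker : Set (ZMod n)) := by
      ext
      simp only [Finset.coe_filter, Finset.mem_univ, true_and, Set.mem_ofPred_eq, SetLike.mem_coe,
        AddMonoidHom.mem_ker, nsmulAddMonoidHom_apply]
    rw [hs]
  · intro h H
    have hd : Nat.card H ∈ n.divisors := by
      refine Nat.mem_divisors.2 ⟨?_, NeZero.ne n⟩
      simpa using H.card_addSubgroup_dvd_card
    rw [← h _ hd, ← finsum_mem_coe_finset]
    have hs : (H : Set (ZMod n)) =
        ((Finset.univ.filter fun g : ZMod n => Nat.card H • g = 0 : Finset (ZMod n)) :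
          Set (ZMod n)) := by
      ext g
      rw [Finset.mem_coe, Finset.mem_filter_univ, SetLike.mem_coe]
      exact mem_iff_card_nsmul_eq_zero H g
    rw [hs]

end Sums

section Rank

variable (n : ℕ) [NeZero n] (hodd : Odd n)

/-- Sums over the torsion subgroups of a function on orbits. -/
noncomputable def torsionSum :
    (Quotient (doublingSetoid n hodd) → ℤ) →ₗ[ℤ] (n.divisors → ℤ) :=
  LinearMap.pi fun d => ∑ g ∈ Finset.univ.filter (fun g : ZMod n => (d : ℕ) • g = 0),
    LinearMap.proj (Quotient.mk _ g)

variable {n hodd} in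
lemma torsionSum_apply (f : Quotient (doublingSetoid n hodd) → ℤ) (d : n.divisors) :
    torsionSum n hodd f d =
      ∑ g ∈ Finset.univ.filter (fun g : ZMod n => (d : ℕ) • g = 0), f (Quotient.mk _ g) := by
  simp [torsionSum, LinearMap.sum_apply]

/-- Pull a function on divisors back to orbits along the order map. -/
noncomputable def orderPullback :
    (n.divisors → ℤ) →ₗ[ℤ] (Quotient (doublingSetoid n hodd) → ℤ) :=
  LinearMap.funLeft ℤ ℤ fun q => ⟨orbitOrder n hodd q, orbitOrder_mem_divisors q⟩

lemma torsionSum_comp_orderPullback_injective :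
    Function.Injective (torsionSum n hodd ∘ₗ orderPullback n hodd) := by
  rw [injective_iff_map_eq_zero]
  intro c hc
  suffices h : ∀ d : ℕ, ∀ hd : d ∈ n.divisors, c ⟨d, hd⟩ = 0 from funext fun d => h d d.2
  intro d
  induction d using Nat.strong_induction_on with
  | _ d ih =>
    intro hd
    have h := congrFun hc ⟨d, hd⟩
    rw [LinearMap.comp_apply, torsionSum_apply] at h
    have hsub : (Finset.univ.filter fun g : ZMod n => addOrderOf g = d) ⊆
        Finset.univ.filter fun g : ZMod n => d • g = 0 := by
      intro g
      simp only [Finset.mem_filter, Finset.mem_univ, true_and]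
      rintro rfl
      exact addOrderOf_nsmul_eq_zero g
    have hpos := Nat.pos_of_mem_divisors hd
    rw [← Finset.sum_subset hsub, Finset.sum_congr rfl (g := fun _ => c ⟨d, hd⟩),
      Finset.sum_const, card_filter_addOrderOf (Nat.mem_divisors.1 hd).1] at h
    · have := Nat.totient_pos.2 hpos
      simpa [this.ne', hpos.ne'] using h
    · intro g hg
      have hg' : addOrderOf g = d := (Finset.mem_filter.1 hg).2
      subst hg'
      rfl
    · intro g hg hg'
      simp only [Finset.mem_filter, Finset.mem_univ, true_and] at hg hg'
      refine ih (addOrderOf g) (lt_of_le_of_ne ?_ hg') _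
      exact Nat.le_of_dvd hpos (addOrderOf_dvd_of_nsmul_eq_zero hg)

lemma finrank_ker_torsionSum :
    Module.finrank ℤ (LinearMap.ker (torsionSum n hodd)) =
      ∑ d ∈ n.divisors.filter (fun d => d ≠ 1), (d.totient / (2 * (Uset d).card) - 1) := by
  have h1 := Submodule.finrank_quotient_add_finrank (LinearMap.ker (torsionSum n hodd))
  rw [(torsionSum n hodd).quotKerEquivRange.finrank_eq, Module.finrank_fintype_fun_eq_card,
    card_orbits] at h1
  have h2 : Module.finrank ℤ (LinearMap.range (torsionSum n hodd)) = n.divisors.card := by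
    have hD : Module.finrank ℤ (n.divisors → ℤ) = n.divisors.card := by simp
    apply le_antisymm
    · rw [← hD]
      exact Submodule.finrank_le _
    · rw [← hD]
      refine LinearMap.finrank_le_finrank_of_injective
        (f := (torsionSum n hodd).rangeRestrict ∘ₗ orderPullback n hodd) ?_
      intro a b hab
      exact torsionSum_comp_orderPullback_injective n hodd (congrArg Subtype.val hab)
  omega

/-- The odd functions on `ℤ/nℤ`. -/
def oddFunctions : Submodule ℤ (ZMod n → ℤ) where
  carrier := {f | ∀ g, f (-g) = -f g}
  add_mem' ha hb g := by
    simp only [Pi.add_apply, ha g, hb g]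
    ring
  zero_mem' g := by simp
  smul_mem' c a ha g := by simp [ha g]

lemma finrank_oddFunctions (hodd : Odd n) : Module.finrank ℤ (oddFunctions n) = (n - 1) / 2 := by
  obtain ⟨m, hm⟩ := hodd
  have hm' : (n - 1) / 2 = m := by omega
  have hF : Module.finrank ℤ (Fin m → ℤ) = m := by simp
  have hval : ∀ i : Fin m, ((i + 1 : ℕ) : ZMod n).val = i + 1 := fun i =>
    ZMod.val_natCast_of_lt (by omega)
  have hne : ∀ i : Fin m, ((i + 1 : ℕ) : ZMod n) ≠ 0 := fun i h => by
    have := hval i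
    rw [h, ZMod.val_zero] at this
    omega
  rw [hm']
  apply le_antisymm
  · conv_rhs => rw [← hF]
    refine LinearMap.finrank_le_finrank_of_injective
      (f := LinearMap.funLeft ℤ ℤ (fun i : Fin m => ((i + 1 : ℕ) : ZMod n)) ∘ₗ
        (oddFunctions n).subtype) ?_
    rw [injective_iff_map_eq_zero]
    rintro ⟨f, hf⟩ h
    have hsmall : ∀ g : ZMod n, g ≠ 0 → g.val ≤ m → f g = 0 := by
      intro g hg hgm
      have hpos : 0 < g.val := ZMod.val_pos.2 hg
      have := congrFun h ⟨g.val - 1, by omega⟩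
      simpa only [LinearMap.comp_apply, LinearMap.funLeft_apply, Submodule.subtype_apply,
        Nat.sub_add_cancel hpos, ZMod.natCast_zmod_val, Pi.zero_apply] using this
    ext g
    change f g = 0
    by_cases hg : g = 0
    · have := hf 0
      rw [neg_zero] at this
      subst hg
      omega
    · by_cases hgm : g.val ≤ m
      · exact hsmall g hg hgm
      · have h1 := hf g
        rw [hsmall (-g) (neg_ne_zero.2 hg)] at h1
        · omega
        · rw [ZMod.neg_val, if_neg hg]
          omega
  · conv_lhs => rw [← hF]
    let e (c : Fin m → ℤ) (g : ZMod n) : ℤ :=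
      if h : 0 < g.val ∧ g.val ≤ m then c ⟨g.val - 1, by omega⟩ else 0
    let L : (Fin m → ℤ) →ₗ[ℤ] oddFunctions n :=
      { toFun := fun c => ⟨fun g => e c g - e c (-g), fun g => by simp only [neg_neg]; ring⟩
        map_add' := fun a b => by
          ext g
          simp only [e, Pi.add_apply, Submodule.coe_add]
          split_ifs <;> ring
        map_smul' := fun r a => by
          ext g
          simp only [e, Pi.smul_apply, Submodule.coe_smul, smul_eq_mul, RingHom.id_apply]
          split_ifs <;> ring }
    refine LinearMap.finrank_le_finrank_of_injective (f := L) ?_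
    rw [injective_iff_map_eq_zero]
    intro c hc
    ext i
    have h : e c ((i + 1 : ℕ) : ZMod n) - e c (-((i + 1 : ℕ) : ZMod n)) = 0 :=
      congrFun (congrArg Subtype.val hc) ((i + 1 : ℕ) : ZMod n)
    have h1 : e c ((i + 1 : ℕ) : ZMod n) = c i := by
      simp only [e, hval i]
      rw [dif_pos (by omega)]
      rfl
    have h2 : e c (-((i + 1 : ℕ) : ZMod n)) = 0 := by
      simp only [e]
      rw [dif_neg]
      rw [ZMod.neg_val, if_neg (hne i), hval i]
      omega
    rw [h1, h2, sub_zero] at h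
    exact h

variable {n}

lemma mem_VM_iff {μ : ZMod n → ℤ} :
    μ ∈ VM n ↔ (∀ g, μ g + μ (-g) = μ (2 * g) + μ (-(2 * g))) ∧
      ∀ d ∈ n.divisors, ∑ g ∈ Finset.univ.filter (fun g : ZMod n => d • g = 0), μ g = 0 := by
  rw [← forall_addSubgroup_sum_iff]
  rfl

lemma sum_torsion_neg (f : ZMod n → ℤ) (d : ℕ) :
    ∑ g ∈ Finset.univ.filter (fun g : ZMod n => d • g = 0), f (-g) =
      ∑ g ∈ Finset.univ.filter (fun g : ZMod n => d • g = 0), f g :=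
  Finset.sum_bij (fun g _ => -g) (by simp) (by simp)
    (fun g hg => ⟨-g, by simpa using hg, neg_neg g⟩) (by simp)

lemma oddFunctions_le_VM : oddFunctions n ≤ VM n := by
  intro f hf
  refine mem_VM_iff.2 ⟨fun g => by rw [hf, hf]; ring, fun d _ => ?_⟩
  have h := sum_torsion_neg f d
  rw [Finset.sum_congr rfl fun g _ => hf g, Finset.sum_neg_distrib] at h
  omega

variable {hodd} in
lemma comp_mk_mem_VM {f : Quotient (doublingSetoid n hodd) → ℤ}
    (hf : f ∈ LinearMap.ker (torsionSum n hodd)) : (fun g => f (Quotient.mk _ g)) ∈ VM n := by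
  have hrel : ∀ {g h : ZMod n}, doublingSetoid n hodd g h →
      Quotient.mk (doublingSetoid n hodd) g = Quotient.mk _ h := fun h => Quotient.sound h
  refine mem_VM_iff.2 ⟨fun g => ?_, fun d hd => ?_⟩
  · have h1 : Quotient.mk (doublingSetoid n hodd) g = Quotient.mk _ (-g) :=
      hrel ⟨0, by simp⟩
    have h2 : Quotient.mk (doublingSetoid n hodd) g = Quotient.mk _ (2 * g) :=
      hrel ⟨1, by simp⟩
    have h3 : Quotient.mk (doublingSetoid n hodd) g = Quotient.mk _ (-(2 * g)) :=
      hrel ⟨1, by simp⟩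
    rw [← h1, ← h2, ← h3]
  · rw [← torsionSum_apply f ⟨d, hd⟩, LinearMap.mem_ker.1 hf]
    rfl

lemma even_part_eq_of_rel {μ : ZMod n → ℤ} (hμ : μ ∈ VM n) {g h : ZMod n}
    (hr : doublingSetoid n hodd g h) : μ g + μ (-g) = μ h + μ (-h) := by
  have key : ∀ i : ℕ, μ g + μ (-g) = μ (2 ^ i * g) + μ (-(2 ^ i * g)) := by
    intro i
    induction i with
    | zero => simp
    | succ i ih => rw [ih, hμ.1, pow_succ', mul_assoc]
  obtain ⟨i, rfl | rfl⟩ := hr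
  · exact key i
  · rw [key i, neg_neg, add_comm]

/-- The map sending an element of `V` to twice its odd part and twice its even part. -/
noncomputable def splitParity :
    VM n →ₗ[ℤ] oddFunctions n × LinearMap.ker (torsionSum n hodd) where
  toFun μ :=
    (⟨fun g => μ.1 g - μ.1 (-g), fun g => by simp only [neg_neg]; ring⟩,
      ⟨Quotient.lift (fun g => μ.1 g + μ.1 (-g)) fun _ _ h => even_part_eq_of_rel hodd μ.2 h, by
        rw [LinearMap.mem_ker]
        ext d
        rw [torsionSum_apply]
        change ∑ g ∈ _, (μ.1 g + μ.1 (-g)) = 0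
        rw [Finset.sum_add_distrib, sum_torsion_neg, (mem_VM_iff.1 μ.2).2 d d.2, add_zero]⟩)
  map_add' a b := by
    refine Prod.ext (Subtype.ext (funext fun g => ?_)) (Subtype.ext (funext fun q => ?_))
    · change a.1 g + b.1 g - (a.1 (-g) + b.1 (-g)) = a.1 g - a.1 (-g) + (b.1 g - b.1 (-g))
      ring
    · induction q using Quotient.inductionOn with
      | h g =>
        change a.1 g + b.1 g + (a.1 (-g) + b.1 (-g)) = a.1 g + a.1 (-g) + (b.1 g + b.1 (-g))
        ring
  map_smul' c a := by
    refine Prod.ext (Subtype.ext (funext fun g => ?_)) (Subtype.ext (funext fun q => ?_))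
    · change c * a.1 g - c * a.1 (-g) = c * (a.1 g - a.1 (-g))
      ring
    · induction q using Quotient.inductionOn with
      | h g =>
        change c * a.1 g + c * a.1 (-g) = c * (a.1 g + a.1 (-g))
        ring

lemma splitParity_injective : Function.Injective (splitParity (n := n) hodd) := by
  rw [injective_iff_map_eq_zero]
  intro μ h
  ext g
  have h1 : μ.1 g - μ.1 (-g) = 0 :=
    congrFun (congrArg (fun p => p.1.1) h) g
  have h2 : μ.1 g + μ.1 (-g) = 0 :=
    congrFun (congrArg (fun p => p.2.1) h) (Quotient.mk _ g)
  change μ.1 g = 0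
  omega

/-- Adding an odd function and a function on orbits with vanishing torsion sums. -/
noncomputable def joinParity :
    oddFunctions n × LinearMap.ker (torsionSum n hodd) →ₗ[ℤ] VM n where
  toFun p := ⟨fun g => p.1.1 g + p.2.1 (Quotient.mk _ g),
    (VM n).add_mem (oddFunctions_le_VM p.1.2) (comp_mk_mem_VM p.2.2)⟩
  map_add' a b := by
    ext g
    change a.1.1 g + b.1.1 g + (a.2.1 _ + b.2.1 _) = a.1.1 g + a.2.1 _ + (b.1.1 g + b.2.1 _)
    ring
  map_smul' c a := by
    ext g
    change c * a.1.1 g + c * a.2.1 _ = c * (a.1.1 g + a.2.1 _)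
    ring

lemma joinParity_injective : Function.Injective (joinParity (n := n) hodd) := by
  rw [injective_iff_map_eq_zero]
  rintro ⟨⟨a, ha⟩, ⟨b, hb⟩⟩ h
  have h0 : ∀ g, a g + b (Quotient.mk _ g) = 0 := fun g => congrFun (congrArg Subtype.val h) g
  have hab : ∀ g, a g = 0 ∧ b (Quotient.mk _ g) = 0 := by
    intro g
    have h1 := h0 g
    have h2 := h0 (-g)
    have hq : Quotient.mk (doublingSetoid n hodd) g = Quotient.mk _ (-g) :=
      Quotient.sound (show doublingSetoid n hodd g (-g) from ⟨0, by simp⟩)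
    rw [← hq, ha g] at h2
    omega
  refine Prod.ext (Subtype.ext (funext fun g => (hab g).1)) (Subtype.ext (funext fun q => ?_))
  induction q using Quotient.inductionOn with
  | h g => exact (hab g).2

lemma finrank_VM (hodd : Odd n) :
    Module.finrank ℤ (VM n) = (n - 1) / 2 +
      ∑ d ∈ n.divisors.filter (fun d => d ≠ 1), (d.totient / (2 * (Uset d).card) - 1) := by
  rw [← finrank_oddFunctions n hodd, ← finrank_ker_torsionSum n hodd, ← Module.finrank_prod]
  exact le_antisymm (LinearMap.finrank_le_finrank_of_injective (splitParity_injective hodd))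
    (LinearMap.finrank_le_finrank_of_injective (joinParity_injective hodd))

end Rank

lemma rank_VM_one : Module.rank ℤ (VM 1) = 0 := by
  have : Subsingleton (VM 1) := by
    refine ⟨fun a b => Subtype.ext (funext fun g => ?_)⟩
    have h : ∀ μ : VM 1, μ.1 g = 0 := fun μ => by
      have h1 := (mem_VM_iff.1 μ.2).2 1 (by simp)
      have h2 : Finset.univ.filter (fun g : ZMod 1 => 1 • g = 0) = {g} := by
        ext x
        exact ⟨fun _ => Finset.mem_singleton.2 (Subsingleton.elim _ _),
          fun _ => Finset.mem_filter.2 ⟨Finset.mem_univ _, Subsingleton.elim _ _⟩⟩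
      rwa [h2, Finset.sum_singleton] at h1
    rw [h a, h b]
  exact rank_subsingleton' _ _

theorem stmt5 (n : ℕ) [NeZero n] (h3 : 3 ≤ n) (hodd : Odd n) :
    Module.rank ℤ ↥(VM n) =
      (((n - 1) / 2 +
        ∑ d ∈ n.divisors.filter (fun d => d ≠ 1),
          (Nat.totient d / (2 * (Uset d).card) - 1) : ℕ) : Cardinal) ∧
    Module.rank ℤ ↥(VM 1) = 0 := by
  refine ⟨?_, rank_VM_one⟩
  rw [← Module.finrank_eq_rank, finrank_VM hodd]
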